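/- arXiv:1203.1429 — 2 statements merged into one kernel-verified Lean document; each statement's English description precedes it below -/
import Mathlib

section
/- For every fixed r > 0, the function z ↦ φ(z, r) = vol(K ∩ {x ∈ ℝⁿ : ‖S x − z‖ ≤ r}) is quasi-concave on ℝˢ: for all z₁, z₂ ∈ ℝˢ and α ∈ [0,1], φ(α z₁ + (1−α) z₂, r) ≥ min(φ(z₁, r), φ(z₂, r)). (Theorem 2(ii), quasi-concavity part; the proof combines the Minkowski-combination inclusion with the Brunn–Minkowski inequality.) -/
open MeasureTheory
open scoped ENNReal Pointwise

theorem pl_amgm (a b : ℝ≥0∞) {α β : ℝ} (hα : 0 < α) (hβ : 0 < β) (hab : α + β = 1) :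
    a ^ α * b ^ β ≤ ENNReal.ofReal α * a + ENNReal.ofReal β * b := by
  have h1 : ENNReal.ofReal α ≠ 0 := by simpa using hα
  have h2 : ENNReal.ofReal β ≠ 0 := by simpa using hβ
  by_cases ha : a = ∞
  · simp [ha, ENNReal.mul_top h1]
  by_cases hb : b = ∞
  · simp [hb, ENNReal.mul_top h2]
  lift a to NNReal using ha
  lift b to NNReal using hb
  lift α to NNReal using hα.le
  lift β to NNReal using hβ.le
  rw [← ENNReal.coe_rpow_of_nonneg _ hα.le, ← ENNReal.coe_rpow_of_nonneg _ hβ.le]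
  simp only [ENNReal.ofReal_coe_nnreal]
  exact_mod_cast NNReal.geom_mean_le_arith_mean2_weighted α β a b (by exact_mod_cast hab)

/-- One-dimensional Brunn–Minkowski for compact sets. -/
theorem bm_compact {A B C : Set ℝ} (hA : IsCompact A) (hB : IsCompact B)
    (hAn : A.Nonempty) (hBn : B.Nonempty) {α β : ℝ} (hα : 0 < α) (hβ : 0 < β)
    (hC : ∀ x ∈ A, ∀ y ∈ B, α * x + β * y ∈ C) :
    ENNReal.ofReal α * volume A + ENNReal.ofReal β * volume B ≤ volume C := by
  obtain ⟨a, haA, ha⟩ := hA.exists_isGreatest hAn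
  obtain ⟨b, hbB, hb⟩ := hB.exists_isLeast hBn
  let U : Set ℝ := (fun x => x + β * b) '' (α • A)
  let V : Set ℝ := (fun x => α * a + x) '' (β • B)
  have hU : volume U = ENNReal.ofReal α * volume A := by
    simp only [U]
    rw [Set.image_add_right, measure_preimage_add_right, Measure.addHaar_smul]
    simp [abs_of_pos hα]
  have hV : volume V = ENNReal.ofReal β * volume B := by
    simp only [V]
    rw [Set.image_add_left, measure_preimage_add, Measure.addHaar_smul]
    simp [abs_of_pos hβ]
  have hVm : MeasurableSet V := ((hB.smul β).image (by fun_prop)).measurableSet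
  have hd : AEDisjoint volume U V := by
    refine measure_mono_null (t := {α * a + β * b}) ?_ (by simp)
    rintro z ⟨⟨_, ⟨x, hx, rfl⟩, rfl⟩, ⟨_, ⟨y, hy, rfl⟩, h⟩⟩
    have h3 : α * x ≤ α * a := by have := ha hx; gcongr
    have h4 : β * b ≤ β * y := by have := hb hy; gcongr
    simp only [smul_eq_mul, Set.mem_singleton_iff] at h ⊢
    linarith
  rw [← hU, ← hV, ← measure_union₀ hVm.nullMeasurableSet hd]
  apply measure_mono
  rintro z (⟨_, ⟨x, hx, rfl⟩, rfl⟩ | ⟨_, ⟨y, hy, rfl⟩, rfl⟩)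
  · exact hC x hx b hbB
  · exact hC a haA y hy

theorem bm_one {A B C : Set ℝ} (hA : MeasurableSet A) (hB : MeasurableSet B)
    (hAn : A.Nonempty) (hBn : B.Nonempty) {α β : ℝ} (hα : 0 < α) (hβ : 0 < β)
    (hC : ∀ x ∈ A, ∀ y ∈ B, α * x + β * y ∈ C) :
    ENNReal.ofReal α * volume A + ENNReal.ofReal β * volume B ≤ volume C := by
  obtain ⟨a, ha⟩ := hAn
  obtain ⟨b, hb⟩ := hBn
  rw [hA.measure_eq_iSup_isCompact, hB.measure_eq_iSup_isCompact]
  have key : ∀ K ⊆ A, IsCompact K → ∀ L ⊆ B, IsCompact L →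
      ENNReal.ofReal α * volume K + ENNReal.ofReal β * volume L ≤ volume C := by
    intro K hKA hK L hLB hL
    have := bm_compact (C := C) (hK.insert a) (hL.insert b) (by simp) (by simp) hα hβ (by
      intro x hx y hy
      refine hC x (Set.insert_subset ha hKA hx) y (Set.insert_subset hb hLB hy))
    refine le_trans ?_ this
    gcongr <;> exact Set.subset_insert _ _
  have e : ∀ (c : ℝ≥0∞) (X : Set ℝ), c * (⨆ (K) (_ : K ⊆ X) (_ : IsCompact K), volume K) =
     ⨆ K : {K // K ⊆ X ∧ IsCompact K}, c * volume K.1 := by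
    intro c X
    simp [ENNReal.mul_iSup, iSup_subtype, iSup_and]
  rw [e, e]
  have : ∀ X : Set ℝ, Nonempty {K // K ⊆ X ∧ IsCompact K} :=
    fun X => ⟨∅, Set.empty_subset _, isCompact_empty⟩
  exact ENNReal.iSup_add_iSup_le fun K L => key _ K.2.1 K.2.2 _ L.2.1 L.2.2

theorem layer {f : ℝ → ℝ≥0∞} (hf : Measurable f) (h1 : ∀ x, f x ≤ 1) :
    ∫⁻ x, f x = ∫⁻ t in Set.Ioo (0:ℝ) 1, volume {x | ENNReal.ofReal t < f x} := by
  have hfin : ∀ x, f x ≠ ∞ := fun x => ne_top_of_le_ne_top (by simp) (h1 x)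
  have := lintegral_eq_lintegral_meas_lt (volume : Measure ℝ) (f := fun x => (f x).toReal)
    (by filter_upwards with x; simp) (by fun_prop)
  simp only [ENNReal.ofReal_toReal (hfin _)] at this
  rw [this]
  have h2 : ∀ t : ℝ, 0 < t → {a | t < (f a).toReal} = {x | ENNReal.ofReal t < f x} := by
    intro t ht; ext x
    simp [ENNReal.ofReal_lt_iff_lt_toReal ht.le (hfin x)]
  rw [setLIntegral_congr_fun measurableSet_Ioi (fun t ht => by rw [h2 t ht])]
  rw [← lintegral_indicator measurableSet_Ioi, ← lintegral_indicator measurableSet_Ioo]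
  congr 1
  ext t
  by_cases h0 : 0 < t
  · by_cases ht : t < 1
    · simp [h0, ht]
    · have : {x | ENNReal.ofReal t < f x} = ∅ := by
        ext x
        simpa using (h1 x).trans (by simpa using ht)
      simp [h0, ht, this]
  · simp [h0]

theorem pl_norm {α β : ℝ} (hα : 0 < α) (hβ : 0 < β) (hab : α + β = 1)
    {f g h : ℝ → ℝ≥0∞} (hf : Measurable f) (hg : Measurable g) (hh : Measurable h)
    (f1 : ⨆ x, f x = 1) (g1 : ⨆ x, g x = 1)
    (H : ∀ x y, f x ^ α * g y ^ β ≤ h (α * x + β * y)) :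
    ENNReal.ofReal α * (∫⁻ x, f x) + ENNReal.ofReal β * (∫⁻ x, g x) ≤ ∫⁻ x, h x := by
  have hf1 : ∀ x, f x ≤ 1 := fun x => f1 ▸ le_iSup f x
  have hg1 : ∀ x, g x ≤ 1 := fun x => g1 ▸ le_iSup g x
  have hle : ∫⁻ x, min (h x) 1 ≤ ∫⁻ x, h x := lintegral_mono fun x => min_le_left _ _
  refine le_trans ?_ hle
  rw [layer hf hf1, layer hg hg1, layer (hh.min measurable_const) (fun x => min_le_right _ _)]
  have anti : ∀ u : ℝ → ℝ≥0∞, Measurable fun t : ℝ => volume {x | ENNReal.ofReal t < u x} := by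
    intro u
    apply Antitone.measurable
    intro s t hst
    apply measure_mono
    intro x hx
    exact lt_of_le_of_lt (ENNReal.ofReal_le_ofReal hst) hx
  rw [← lintegral_const_mul _ (anti f), ← lintegral_const_mul _ (anti g),
    ← lintegral_add_left ((anti f).const_mul _)]
  refine setLIntegral_mono (anti _) fun t ht => ?_
  have ht1 : ENNReal.ofReal t < 1 := by simpa using ht.2
  refine bm_one (measurableSet_lt measurable_const hf) (measurableSet_lt measurable_const hg)
    ?_ ?_ hα hβ ?_
  · exact lt_iSup_iff.1 (f1 ▸ ht1)
  · exact lt_iSup_iff.1 (g1 ▸ ht1)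
  · intro x hx y hy
    refine lt_min (lt_of_lt_of_le ?_ (H x y)) ht1
    have : ENNReal.ofReal t = ENNReal.ofReal t ^ α * ENNReal.ofReal t ^ β := by
      rw [← ENNReal.rpow_add _ _ (by simpa using ht.1) (by simp), hab, ENNReal.rpow_one]
    rw [this]
    exact ENNReal.mul_lt_mul (ENNReal.rpow_lt_rpow hx hα) (ENNReal.rpow_lt_rpow hy hβ)

theorem pl_bdd {α β : ℝ} (hα : 0 < α) (hβ : 0 < β) (hab : α + β = 1)
    {f g h : ℝ → ℝ≥0∞} (hf : Measurable f) (hg : Measurable g) (hh : Measurable h)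
    (f1 : ⨆ x, f x ≠ ∞) (g1 : ⨆ x, g x ≠ ∞)
    (H : ∀ x y, f x ^ α * g y ^ β ≤ h (α * x + β * y)) :
    (∫⁻ x, f x) ^ α * (∫⁻ x, g x) ^ β ≤ ∫⁻ x, h x := by
  by_cases f0 : ⨆ x, f x = 0
  · have : ∀ x, f x = 0 := by simpa using f0
    simp [this, hα]
  by_cases g0 : ⨆ x, g x = 0
  · have : ∀ x, g x = 0 := by simpa using g0
    simp [this, hβ]
  set M := ⨆ x, f x with hM
  set L := ⨆ x, g x with hL
  have P0 : M ^ α * L ^ β ≠ 0 := by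
    simp [f0, g0, f1, g1]
  have P1 : M ^ α * L ^ β ≠ ∞ :=
    ENNReal.mul_ne_top (ENNReal.rpow_ne_top_of_nonneg hα.le f1)
      (ENNReal.rpow_ne_top_of_nonneg hβ.le g1)
  have dv : ∀ a b : ℝ≥0∞, (a / M) ^ α * (b / L) ^ β = (a ^ α * b ^ β) / (M ^ α * L ^ β) := by
    intro a b
    rw [ENNReal.div_rpow_of_nonneg _ _ hα.le, ENNReal.div_rpow_of_nonneg _ _ hβ.le]
    simp only [div_eq_mul_inv]
    rw [ENNReal.mul_inv (Or.inl (by simp [f0, f1])) (Or.inl (ENNReal.rpow_ne_top_of_nonneg hα.le f1))]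
    ring
  have key := pl_norm hα hβ hab (f := fun x => f x / M) (g := fun x => g x / L)
    (h := fun x => h x / (M ^ α * L ^ β)) (hf.div_const _) (hg.div_const _) (hh.div_const _)
    (by rw [← ENNReal.iSup_div, ← hM, ENNReal.div_self f0 f1])
    (by rw [← ENNReal.iSup_div, ← hL, ENNReal.div_self g0 g1])
    (by intro x y
        rw [dv]
        exact ENNReal.div_le_div_right (H x y) _)
  have key2 := (pl_amgm _ _ hα hβ hab).trans key
  simp only [div_eq_mul_inv] at key2
  rw [lintegral_mul_const _ hf, lintegral_mul_const _ hg, lintegral_mul_const _ hh] at key2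
  simp only [← div_eq_mul_inv] at key2
  rw [dv] at key2
  have key3 := mul_le_mul_left key2 (M ^ α * L ^ β)
  rwa [ENNReal.div_mul_cancel P0 P1, ENNReal.div_mul_cancel P0 P1] at key3

/-- The Prékopa–Leindler property of a space with a measure. -/
def PL (α β : ℝ) (E : Type) [AddCommGroup E] [Module ℝ E] [MeasureSpace E] : Prop :=
  ∀ f g h : E → ℝ≥0∞, Measurable f → Measurable g → Measurable h →
    (∀ x y, f x ^ α * g y ^ β ≤ h (α • x + β • y)) →
    (∫⁻ x, f x) ^ α * (∫⁻ x, g x) ^ β ≤ ∫⁻ x, h x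

theorem trunc {f : ℝ → ℝ≥0∞} (hf : Measurable f) {α : ℝ} (hα : 0 < α) :
    (∫⁻ x, f x) ^ α = ⨆ k : ℕ, (∫⁻ x, min (f x) k) ^ α := by
  have h1 : ∀ x, f x = ⨆ k : ℕ, min (f x) k := by
    intro x
    rw [← inf_iSup_eq, ENNReal.iSup_natCast, inf_top_eq]
  rw [lintegral_congr h1]
  rw [lintegral_iSup (fun k => hf.min measurable_const)]
  · exact (ENNReal.orderIsoRpow α hα).map_iSup _
  · intro i j hij x
    dsimp only
    gcongr

theorem pl_real {α β : ℝ} (hα : 0 < α) (hβ : 0 < β) (hab : α + β = 1) : PL α β ℝ := by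
  intro f g h hf hg hh H
  rw [trunc hf hα, trunc hg hβ]
  simp only [ENNReal.iSup_mul, ENNReal.mul_iSup]
  have fin : ∀ (u : ℝ → ℝ≥0∞) (k : ℕ), ⨆ x, min (u x) (k : ℝ≥0∞) ≠ ∞ := fun u k =>
    ne_top_of_le_ne_top (ENNReal.natCast_ne_top k) (iSup_le fun x => min_le_right _ _)
  refine iSup_le fun i => iSup_le fun j => ?_
  refine pl_bdd hα hβ hab (hf.min measurable_const) (hg.min measurable_const) hh
    (fin _ _) (fin _ _) fun x y => le_trans ?_ (H x y)
  gcongr <;> exact min_le_left _ _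

theorem pl_prod {α β : ℝ} (hα : 0 < α) (hβ : 0 < β) (hab : α + β = 1)
    (E : Type) [AddCommGroup E] [Module ℝ E] [MeasureSpace E] [SFinite (volume : Measure E)]
    (hE : PL α β E) : PL α β (ℝ × E) := by
  intro f g h hf hg hh H
  rw [Measure.volume_eq_prod, lintegral_prod _ hf.aemeasurable, lintegral_prod _ hg.aemeasurable,
    lintegral_prod _ hh.aemeasurable]
  refine pl_real hα hβ hab _ _ _ hf.lintegral_prod_right' hg.lintegral_prod_right'
    hh.lintegral_prod_right' ?_
  intro x y
  exact hE _ _ _ (hf.comp measurable_prodMk_left) (hg.comp measurable_prodMk_left)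
    (hh.comp measurable_prodMk_left) fun u v => H (x, u) (y, v)

theorem pl_pi {α β : ℝ} (hα : 0 < α) (hβ : 0 < β) (hab : α + β = 1) (n : ℕ) :
    PL α β (Fin n → ℝ) := by
  induction n with
  | zero =>
    intro f g h hf hg hh H
    have := H default default
    rw [Subsingleton.elim (α • (default : Fin 0 → ℝ) + β • default) default] at this
    have v : volume (Set.univ : Set (Fin 0 → ℝ)) = 1 := by
      rw [volume_pi, Measure.pi_of_empty _ default]; simp
    simp only [lintegral_unique, v, mul_one]
    convert this
  | succ n ih =>
    intro f g h hf hg hh H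
    have mp := (volume_preserving_piFinSuccAbove (fun _ : Fin (n + 1) => ℝ) 0).symm
    rw [← mp.lintegral_comp hf, ← mp.lintegral_comp hg, ← mp.lintegral_comp hh]
    refine pl_prod hα hβ hab _ ih _ _ _ (hf.comp mp.measurable) (hg.comp mp.measurable)
      (hh.comp mp.measurable) fun x y => (H _ _).trans_eq ?_
    congr 1
    ext i
    refine Fin.cases ?_ (fun i => ?_) i <;>
      simp [MeasurableEquiv.piFinSuccAbove]

/-- Brunn–Minkowski, quasi-concave form. -/
theorem bm_min {n : ℕ} {α β : ℝ} (hα : 0 < α) (hβ : 0 < β) (hab : α + β = 1)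
    {A B C : Set (Fin n → ℝ)} (hA : MeasurableSet A) (hB : MeasurableSet B) (hC : MeasurableSet C)
    (H : ∀ x ∈ A, ∀ y ∈ B, α • x + β • y ∈ C) : min (volume A) (volume B) ≤ volume C := by
  have := pl_pi hα hβ hab n (A.indicator 1) (B.indicator 1) (C.indicator 1)
    (measurable_one.indicator hA) (measurable_one.indicator hB) (measurable_one.indicator hC) (by
      intro x y
      by_cases hx : x ∈ A <;> by_cases hy : y ∈ B <;> simp [hx, hy, hα, hβ, H])
  rw [lintegral_indicator_one hA, lintegral_indicator_one hB, lintegral_indicator_one hC] at this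
  refine le_trans ?_ this
  set m := min (volume A) (volume B) with hm
  calc m = m ^ α * m ^ β := by
        rw [← ENNReal.rpow_add_of_nonneg _ _ hα.le hβ.le, hab, ENNReal.rpow_one]
    _ ≤ _ := by
        gcongr
        · exact min_le_left _ _
        · exact min_le_right _ _




/-- Theorem 2(ii), quasi-concavity: for fixed `r > 0`, the function
`z ↦ vol (K ∩ {x | ‖S x - z‖ ≤ r})` is quasi-concave on `ℝˢ`. -/
theorem volume_intersection_quasiConcave {n s : ℕ}
    (K : Set (Fin n → ℝ)) (hK : IsCompact K) (hKconv : Convex ℝ K)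
    (hKvol : 0 < volume K)
    (S : (Fin n → ℝ) →ₗ[ℝ] (Fin s → ℝ)) (hS : Function.Surjective S)
    (N : Seminorm ℝ (Fin s → ℝ)) (hN : ∀ v, N v = 0 → v = 0)
    (r : ℝ) (hr : 0 < r) (z₁ z₂ : Fin s → ℝ) (α : ℝ) (hα : α ∈ Set.Icc (0 : ℝ) 1) :
    min (volume (K ∩ {x | N (S x - z₁) ≤ r})) (volume (K ∩ {x | N (S x - z₂) ≤ r})) ≤
      volume (K ∩ {x | N (S x - (α • z₁ + (1 - α) • z₂)) ≤ r}) := by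
  have hc : ∀ z, MeasurableSet (K ∩ {x | N (S x - z) ≤ r}) := by
    intro z
    have hNc : Continuous N := by
      have := (Seminorm.convexOn N).continuousOn isOpen_univ
      exact continuousOn_univ.1 this
    have hSc : Continuous S := S.continuous_of_finiteDimensional
    exact hK.measurableSet.inter
      (isClosed_le (hNc.comp (hSc.sub continuous_const)) continuous_const).measurableSet
  rcases hα.1.eq_or_lt with h0 | h0
  · subst h0; simp
  rcases hα.2.eq_or_lt with h1 | h1
  · subst h1; simp
  refine bm_min h0 (sub_pos.2 h1) (by ring) (hc _) (hc _) (hc _) ?_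
  rintro x ⟨hxK, hx⟩ y ⟨hyK, hy⟩
  refine ⟨hKconv hxK hyK h0.le (sub_pos.2 h1).le (by ring), ?_⟩
  simp only [Set.mem_ofPred_eq] at hx hy ⊢
  have e : S (α • x + (1 - α) • y) - (α • z₁ + (1 - α) • z₂)
      = α • (S x - z₁) + (1 - α) • (S y - z₂) := by
    simp only [map_add, map_smul, smul_sub]; abel
  rw [e]
  refine (map_add_le_add N _ _).trans ?_
  rw [map_smul_eq_mul, map_smul_eq_mul, Real.norm_of_nonneg h0.le,
    Real.norm_of_nonneg (sub_pos.2 h1).le]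
  have := sub_pos.2 h1
  nlinarith
end

section
/- Suppose in addition that K is centrally symmetric with center x̄, i.e. x ∈ K implies 2x̄ − x ∈ K. Then for every r > 0 and every z ∈ ℝˢ, vol(K ∩ {x : ‖S x − z‖ ≤ r}) ≤ vol(K ∩ {x : ‖S x − S x̄‖ ≤ r}); that is, the center S x̄ maximizes the volume of the intersection of K with the cylinder, so the probabilistic optimal estimate coincides with the center of symmetry. (Claim made for centrally symmetric consistency sets in Section 4.) -/
open MeasureTheory
open scoped Pointwise

/-- One-dimensional Brunn-Minkowski, compact sets. -/
theorem bm1_compact (K L C : Set ℝ) (hK : IsCompact K) (hL : IsCompact L)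
    (hKn : K.Nonempty) (hLn : L.Nonempty) (h : ∀ x ∈ K, ∀ y ∈ L, x + y ∈ C) :
    volume K + volume L ≤ volume C := by
  obtain ⟨a, haK, ha⟩ := hK.exists_isGreatest hKn
  obtain ⟨b, hbL, hb⟩ := hL.exists_isLeast hLn
  have h1 : volume ((fun x => -b + x) ⁻¹' K) = volume K := measure_preimage_add _ _ _
  have h2 : volume ((fun x => -a + x) ⁻¹' L) = volume L := measure_preimage_add _ _ _
  have hm : MeasurableSet ((fun x => -a + x) ⁻¹' L) :=
    hL.measurableSet.preimage (measurable_const_add _)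
  rw [← h1, ← h2, ← measure_union₀ hm.nullMeasurableSet]
  · apply measure_mono
    rintro x (hx | hx)
    · have := h _ hx _ hbL
      simpa using this
    · have := h _ haK _ hx
      simpa using this
  · refine measure_mono_null (t := {a + b}) ?_ (by simp)
    rintro x ⟨hx, hx'⟩
    have e1 := ha hx
    have e2 := hb hx'
    simp only [Set.mem_singleton_iff]
    linarith

/-- One-dimensional Brunn-Minkowski, measurable sets. -/
theorem bm1 (A B C : Set ℝ) (hA : MeasurableSet A) (hB : MeasurableSet B)
    (hAn : A.Nonempty) (hBn : B.Nonempty) (h : ∀ x ∈ A, ∀ y ∈ B, x + y ∈ C) :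
    volume A + volume B ≤ volume C := by
  obtain ⟨a, ha⟩ := hAn
  obtain ⟨b, hb⟩ := hBn
  have key : ∀ K ⊆ A, IsCompact K → ∀ L ⊆ B, IsCompact L →
      volume K + volume L ≤ volume C := by
    intro K hKA hK L hLB hL
    refine le_trans (add_le_add (measure_mono (Set.subset_insert a K))
      (measure_mono (Set.subset_insert b L))) ?_
    apply bm1_compact _ _ _ (hK.insert a) (hL.insert b) ⟨a, by simp⟩ ⟨b, by simp⟩
    intro x hx y hy
    exact h x (Set.insert_subset ha hKA hx) y (Set.insert_subset hb hLB hy)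
  rw [hA.measure_eq_iSup_isCompact, hB.measure_eq_iSup_isCompact]
  simp_rw [iSup_and']
  exact ENNReal.biSup_add_biSup_le' ⟨∅, by simp⟩ ⟨∅, by simp⟩
    fun K hK L hL => key K hK.1 hK.2 L hL.1 hL.2

/-- Normalized one-dimensional Prékopa-Leindler. -/
theorem pl1_norm (f g h : ℝ → ℝ) (hf : Measurable f) (hg : Measurable g) (hh : Measurable h)
    (f0 : ∀ x, 0 ≤ f x) (g0 : ∀ x, 0 ≤ g x) (h0 : ∀ x, 0 ≤ h x)
    (f1 : ∀ x, f x ≤ 1) (g1 : ∀ x, g x ≤ 1)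
    (fs : ∀ t < 1, ∃ x, t < f x) (gs : ∀ t < 1, ∃ x, t < g x)
    (H : ∀ x y, f x * g y ≤ h (x + y) ^ 2) :
    (∫⁻ x, ENNReal.ofReal (f x)) + (∫⁻ x, ENNReal.ofReal (g x)) ≤
      ∫⁻ x, ENNReal.ofReal (h x) := by
  rw [lintegral_eq_lintegral_meas_lt _ (.of_forall f0) hf.aemeasurable,
    lintegral_eq_lintegral_meas_lt _ (.of_forall g0) hg.aemeasurable,
    lintegral_eq_lintegral_meas_lt _ (.of_forall h0) hh.aemeasurable,
    ← lintegral_add_left]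
  · apply setLIntegral_mono' measurableSet_Ioi
    intro t ht
    have ht0 : 0 < t := ht
    by_cases h1 : t < 1
    · apply bm1 _ _ _ (measurableSet_lt measurable_const hf)
        (measurableSet_lt measurable_const hg) (fs t h1) (gs t h1)
      intro x hx y hy
      simp only [Set.mem_ofPred_eq] at hx hy ⊢
      have := H x y
      by_contra hc
      push Not at hc
      nlinarith [h0 (x + y)]
    · have e1 : {a | t < f a} = ∅ := by
        ext x; simp only [Set.mem_ofPred_eq, Set.mem_empty_iff_false, iff_false]
        linarith [f1 x]
      have e2 : {a | t < g a} = ∅ := by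
        ext x; simp only [Set.mem_ofPred_eq, Set.mem_empty_iff_false, iff_false]
        linarith [g1 x]
      simp [e1, e2]
  · apply Antitone.measurable
    intro s t hst
    apply measure_mono
    intro x hx
    exact lt_of_le_of_lt hst hx

theorem four_mul_le (a b c : ENNReal) (h : a + b ≤ c) : 4 * a * b ≤ c ^ 2 := by
  refine le_trans ?_ (pow_le_pow_left' h 2)
  rcases eq_or_ne a ⊤ with rfl | ha
  · simp
  rcases eq_or_ne b ⊤ with rfl | hb
  · simp
  lift a to NNReal using ha
  lift b to NNReal using hb
  have : 4 * a * b ≤ (a + b) ^ 2 := by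
    rw [← NNReal.coe_le_coe]; push_cast
    nlinarith [sq_nonneg ((a : ℝ) - b)]
  exact_mod_cast this

/-- Bounded one-dimensional Prékopa-Leindler. -/
theorem pl1_bdd (f g h : ℝ → ENNReal) (hf : Measurable f) (hg : Measurable g) (hh : Measurable h)
    (fb : ⨆ x, f x ≠ ⊤) (gb : ⨆ x, g x ≠ ⊤)
    (H : ∀ x y, f x * g y ≤ h (x + y) ^ 2) :
    4 * (∫⁻ x, f x) * (∫⁻ x, g x) ≤ (∫⁻ x, h x) ^ 2 := by
  obtain ⟨a, ha⟩ : ∃ a : NNReal, (a : ENNReal) = ⨆ x, f x := ⟨_, ENNReal.coe_toNNReal fb⟩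
  obtain ⟨b, hb⟩ : ∃ b : NNReal, (b : ENNReal) = ⨆ x, g x := ⟨_, ENNReal.coe_toNNReal gb⟩
  have fa : ∀ x, f x ≤ a := fun x => ha ▸ le_iSup f x
  have ga : ∀ x, g x ≤ b := fun x => hb ▸ le_iSup g x
  rcases eq_or_ne a 0 with rfl | ha0
  · have : f = 0 := by ext x; simpa using fa x
    simp [this]
  rcases eq_or_ne b 0 with rfl | hb0
  · have : g = 0 := by ext x; simpa using ga x
    simp [this]
  have hapos : 0 < (a : ℝ) := by positivity
  have hbpos : 0 < (b : ℝ) := by positivity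
  set c : NNReal := NNReal.sqrt (a * b) with hc
  have hcc : c ^ 2 = a * b := by simp [hc]
  have hcc' : (c : ℝ) ^ 2 = a * b := by exact_mod_cast hcc
  have hcpos : 0 < (c : ℝ) := by
    have : 0 < c := by rw [hc]; positivity
    exact_mod_cast this
  have ft : ∀ x, f x ≠ ⊤ := fun x => ne_top_of_le_ne_top ENNReal.coe_ne_top (fa x)
  have gt : ∀ x, g x ≠ ⊤ := fun x => ne_top_of_le_ne_top ENNReal.coe_ne_top (ga x)
  have ht : ∀ x, min (h x) c ≠ ⊤ := fun x =>
    ne_top_of_le_ne_top ENNReal.coe_ne_top (min_le_right _ _)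
  have repr : ∀ (u : ENNReal) (d : NNReal), 0 < (d : ℝ) → u ≠ ⊤ →
      u = d * ENNReal.ofReal (u.toReal / d) := by
    intro u d hd hu
    rw [← ENNReal.ofReal_coe_nnreal, ← ENNReal.ofReal_mul hd.le, mul_div_cancel₀ _ hd.ne',
      ENNReal.ofReal_toReal hu]
  have main := pl1_norm (fun x => (f x).toReal / a) (fun x => (g x).toReal / b)
    (fun x => (min (h x) c).toReal / c)
    (hf.ennreal_toReal.div_const _) (hg.ennreal_toReal.div_const _)
    ((hh.min measurable_const).ennreal_toReal.div_const _)
    (fun x => by positivity) (fun x => by positivity) (fun x => by positivity)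
    (fun x => by
      rw [div_le_one hapos]; exact ENNReal.toReal_mono ENNReal.coe_ne_top (fa x))
    (fun x => by
      rw [div_le_one hbpos]; exact ENNReal.toReal_mono ENNReal.coe_ne_top (ga x))
    (fun t ht1 => by
      by_contra! hcon
      have : (⨆ x, f x) ≤ ENNReal.ofReal (t * a) := iSup_le fun x => by
        have h1 := hcon x
        rw [div_le_iff₀ hapos] at h1
        exact (ENNReal.le_ofReal_iff_toReal_le (ft x) (le_trans (by positivity) h1)).2 h1
      rw [← ha, ← ENNReal.ofReal_coe_nnreal, ENNReal.ofReal_le_ofReal_iff'] at this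
      rcases this with h | h <;> nlinarith)
    (fun t ht1 => by
      by_contra! hcon
      have : (⨆ x, g x) ≤ ENNReal.ofReal (t * b) := iSup_le fun x => by
        have h1 := hcon x
        rw [div_le_iff₀ hbpos] at h1
        exact (ENNReal.le_ofReal_iff_toReal_le (gt x) (le_trans (by positivity) h1)).2 h1
      rw [← hb, ← ENNReal.ofReal_coe_nnreal, ENNReal.ofReal_le_ofReal_iff'] at this
      rcases this with h | h <;> nlinarith)
    (fun x y => by
      have h1 : f x * g y ≤ (min (h (x + y)) c) ^ 2 := by
        rcases min_choice (h (x + y)) (c : ENNReal) with e | e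
        · rw [e]; exact H x y
        · rw [e]
          calc f x * g y ≤ a * b := mul_le_mul' (fa x) (ga y)
            _ = (c : ENNReal) ^ 2 := by exact_mod_cast hcc.symm
      have h2 := ENNReal.toReal_mono (ENNReal.pow_ne_top (ht _)) h1
      rw [ENNReal.toReal_mul, ENNReal.toReal_pow] at h2
      rw [div_mul_div_comm, div_pow, hcc']
      gcongr)
  have m4 := four_mul_le _ _ _ main
  have ef : ∫⁻ x, f x = a * ∫⁻ x, ENNReal.ofReal ((f x).toReal / a) := by
    rw [← lintegral_const_mul' _ _ ENNReal.coe_ne_top]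
    exact lintegral_congr fun x => repr _ _ hapos (ft x)
  have eg : ∫⁻ x, g x = b * ∫⁻ x, ENNReal.ofReal ((g x).toReal / b) := by
    rw [← lintegral_const_mul' _ _ ENNReal.coe_ne_top]
    exact lintegral_congr fun x => repr _ _ hbpos (gt x)
  have eh : c * ∫⁻ x, ENNReal.ofReal ((min (h x) c).toReal / c) ≤ ∫⁻ x, h x := by
    rw [← lintegral_const_mul' _ _ ENNReal.coe_ne_top]
    refine lintegral_mono fun x => ?_
    rw [← repr _ _ hcpos (ht x)]
    exact min_le_left _ _
  refine le_trans ?_ (pow_le_pow_left' eh 2)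
  rw [ef, eg, mul_pow]
  have hcc2 : (c : ENNReal) ^ 2 = a * b := by exact_mod_cast hcc
  rw [hcc2]
  refine le_trans (le_of_eq ?_) (mul_le_mul_right m4 _)
  ring

/-- One-dimensional Prékopa-Leindler. -/
theorem pl1 (f g h : ℝ → ENNReal) (hf : Measurable f) (hg : Measurable g) (hh : Measurable h)
    (H : ∀ x y, f x * g y ≤ h (x + y) ^ 2) :
    4 * (∫⁻ x, f x) * (∫⁻ x, g x) ≤ (∫⁻ x, h x) ^ 2 := by
  have trunc : ∀ u : ℝ → ENNReal, Measurable u →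
      ∫⁻ x, u x = ⨆ k : ℕ, ∫⁻ x, min (u x) k := by
    intro u hu
    rw [← lintegral_iSup]
    · refine lintegral_congr fun x => ?_
      rw [← inf_iSup_eq, ENNReal.iSup_natCast, inf_top_eq]
    · exact fun k => hu.min measurable_const
    · intro i j hij x
      exact min_le_min le_rfl (by exact_mod_cast hij)
  rw [trunc f hf, trunc g hg, ENNReal.mul_iSup]
  refine iSup_le fun j => ?_
  rw [ENNReal.mul_iSup, ENNReal.iSup_mul]
  refine iSup_le fun i => ?_
  refine pl1_bdd _ _ _ (hf.min measurable_const) (hg.min measurable_const) hh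
    (ne_top_of_le_ne_top (ENNReal.natCast_ne_top i) (iSup_le fun x => min_le_right _ _))
    (ne_top_of_le_ne_top (ENNReal.natCast_ne_top j) (iSup_le fun x => min_le_right _ _)) ?_
  intro x y
  exact (mul_le_mul' (min_le_left _ _) (min_le_left _ _)).trans (H x y)

theorem lint_cons {n : ℕ} (f : (Fin (n + 1) → ℝ) → ENNReal) (hf : Measurable f) :
    (Measurable fun p : ℝ × (Fin n → ℝ) => f (Fin.cons p.1 p.2)) ∧
    ∫⁻ x, f x = ∫⁻ t : ℝ, ∫⁻ y : Fin n → ℝ, f (Fin.cons t y) := by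
  have mp := (volume_preserving_piFinSuccAbove (fun _ : Fin (n + 1) => ℝ) 0).symm
  have hm : Measurable fun p : ℝ × (Fin n → ℝ) => f (Fin.cons p.1 p.2) := by
    have := hf.comp mp.measurable
    convert this using 1
    ext p
    simp [MeasurableEquiv.piFinSuccAbove, Fin.insertNthEquiv]
  refine ⟨hm, ?_⟩
  rw [← mp.lintegral_comp hf, Measure.volume_eq_prod, ← lintegral_prod _ hm.aemeasurable]
  refine lintegral_congr fun p => ?_
  simp [MeasurableEquiv.piFinSuccAbove, Fin.insertNthEquiv]

/-- Prékopa-Leindler. -/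
theorem pl (n : ℕ) : ∀ (f g h : (Fin n → ℝ) → ENNReal), Measurable f → Measurable g →
    Measurable h → (∀ x y, f x * g y ≤ h (x + y) ^ 2) →
    4 ^ n * (∫⁻ x, f x) * (∫⁻ x, g x) ≤ (∫⁻ x, h x) ^ 2 := by
  induction n with
  | zero =>
    intro f g h hf hg hh H
    have e : (volume : Measure (Fin 0 → ℝ)) Set.univ = 1 := by
      rw [volume_pi, Measure.pi_univ]; simp
    rw [lintegral_unique, lintegral_unique, lintegral_unique, e]
    have := H default default
    rw [Subsingleton.elim (default + default : Fin 0 → ℝ) default] at this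
    simp only [pow_zero, one_mul, mul_one]
    convert this
  | succ n ih =>
    intro f g h hf hg hh H
    obtain ⟨mf, ef⟩ := lint_cons f hf
    obtain ⟨mg, eg⟩ := lint_cons g hg
    obtain ⟨mh, eh⟩ := lint_cons h hh
    have key := pl1 (fun t => 4 ^ n * ∫⁻ y : Fin n → ℝ, f (Fin.cons t y))
      (fun t => ∫⁻ y : Fin n → ℝ, g (Fin.cons t y))
      (fun t => ∫⁻ y : Fin n → ℝ, h (Fin.cons t y))
      (mf.lintegral_prod_right'.const_mul _) mg.lintegral_prod_right' mh.lintegral_prod_right'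
      (fun s t => by
        refine ih _ _ _ (mf.comp measurable_prodMk_left) (mg.comp measurable_prodMk_left)
          (mh.comp measurable_prodMk_left) ?_
        intro x y
        have e : (Fin.cons (s + t) (x + y) : Fin (n + 1) → ℝ) =
            Fin.cons s x + Fin.cons t y := by
          ext i
          refine Fin.cases ?_ (fun j => ?_) i <;> simp
        have := H (Fin.cons s x) (Fin.cons t y)
        rw [← e] at this
        exact this)
    rw [lintegral_const_mul _ mf.lintegral_prod_right', ← ef, ← eg, ← eh] at key
    refine le_trans (le_of_eq ?_) key
    ring

theorem bm (n : ℕ) (A B C : Set (Fin n → ℝ)) (hA : MeasurableSet A) (hB : MeasurableSet B)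
    (hC : MeasurableSet C) (H : ∀ x ∈ A, ∀ y ∈ B, x + y ∈ C) :
    4 ^ n * volume A * volume B ≤ volume C ^ 2 := by
  have := pl n (A.indicator 1) (B.indicator 1) (C.indicator 1)
    (measurable_one.indicator hA) (measurable_one.indicator hB) (measurable_one.indicator hC)
    (fun x y => by
      by_cases hx : x ∈ A <;> by_cases hy : y ∈ B <;> simp [hx, hy, H])
  rwa [lintegral_indicator_one hA, lintegral_indicator_one hB, lintegral_indicator_one hC] at this

/-- For a centrally symmetric consistency set `K` with center `x̄`, the center `S x̄`
maximizes the volume of the intersection of `K` with the cylinder: for every `r > 0`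
and every `z`, `vol (K ∩ {x | ‖S x - z‖ ≤ r}) ≤ vol (K ∩ {x | ‖S x - S x̄‖ ≤ r})`. -/
theorem centrally_symmetric_center_optimal {n s : ℕ}
    (K : Set (Fin n → ℝ)) (hK : IsCompact K) (hKconv : Convex ℝ K)
    (hKvol : 0 < volume K)
    (S : (Fin n → ℝ) →ₗ[ℝ] (Fin s → ℝ)) (hS : Function.Surjective S)
    (N : Seminorm ℝ (Fin s → ℝ)) (hN : ∀ v, N v = 0 → v = 0)
    (xbar : Fin n → ℝ) (hsym : ∀ x ∈ K, (2 : ℝ) • xbar - x ∈ K) :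
    ∀ r : ℝ, 0 < r → ∀ z : Fin s → ℝ,
      volume (K ∩ {x | N (S x - z) ≤ r}) ≤
        volume (K ∩ {x | N (S x - S xbar) ≤ r}) := by
  intro r hr z
  have hNc : Continuous N := by
    rw [← continuousOn_univ]
    exact N.convexOn.continuousOn isOpen_univ
  have hSc : Continuous S := S.continuous_of_finiteDimensional
  have meas : ∀ w, MeasurableSet (K ∩ {x | N (S x - w) ≤ r}) := fun w =>
    hK.measurableSet.inter
      (isClosed_le (hNc.comp (hSc.sub continuous_const)) continuous_const).measurableSet
  set A := K ∩ {x | N (S x - z) ≤ r} with hA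
  set B := K ∩ {x | N (S x - S xbar) ≤ r} with hB
  have mp := Measure.measurePreserving_sub_left (volume : Measure (Fin n → ℝ)) ((2 : ℝ) • xbar)
  set A' := (fun t => (2 : ℝ) • xbar - t) ⁻¹' A with hA'
  have mA' : MeasurableSet A' := mp.measurable (meas z)
  have vA' : volume A' = volume A := mp.measure_preimage (meas z).nullMeasurableSet
  have mC : MeasurableSet ((2 : ℝ) • B) := (meas _).const_smul_of_ne_zero two_ne_zero
  have main := bm n A A' ((2 : ℝ) • B) (meas z) mA' mC (by
    rintro x ⟨hxK, hx⟩ y ⟨hyK, hy⟩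
    rw [Set.mem_smul_set_iff_inv_smul_mem₀ two_ne_zero]
    have hyK' : y ∈ K := by simpa using hsym _ hyK
    simp only [Set.mem_ofPred_eq] at hx hy
    refine ⟨?_, ?_⟩
    · have := hKconv hxK hyK' (a := 2⁻¹) (b := 2⁻¹) (by norm_num) (by norm_num) (by norm_num)
      rwa [← smul_add] at this
    · simp only [Set.mem_ofPred_eq]
      have e : S ((2 : ℝ)⁻¹ • (x + y)) - S xbar =
          (2 : ℝ)⁻¹ • ((S x - z) - (S ((2 : ℝ) • xbar - y) - z)) := by
        ext i
        simp
        ring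
      rw [e, map_smul_eq_mul]
      have := map_sub_le_add N (S x - z) (S ((2 : ℝ) • xbar - y) - z)
      rw [Real.norm_of_nonneg (by norm_num)]
      linarith)
  rw [vA', Measure.addHaar_smul, Module.finrank_fin_fun] at main
  have e2 : ENNReal.ofReal |(2 : ℝ) ^ n| = 2 ^ n := by
    rw [abs_of_pos (by positivity), ENNReal.ofReal_pow (by norm_num)]; simp
  have e4 : (4 : ENNReal) ^ n = (2 ^ n) ^ 2 := by
    rw [← pow_mul, mul_comm n 2, pow_mul]; norm_num
  rw [e2, e4, mul_assoc, ← sq, ← mul_pow] at main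
  have h3 := (ENNReal.pow_le_pow_left_iff two_ne_zero).1 main
  exact (ENNReal.mul_le_mul_iff_right (by positivity) (by simp)).1 h3
end
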